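/- Set b = α̇ − α·β̇/β and suppose b ≠ 0. Then the marginal velocity u is differentiable on ℝ^d and its Fréchet derivative at any x ∈ ℝ^d satisfies, for every direction z ∈ ℝ^d, (Du(x)) z = (β̇/β)·z + (α/(β²·b)) · (1/p(x)) · ∫ ⟨v(x, y) − u(x), z⟩ · (v(x, y) − u(x)) · g(x, y) dμ(y); that is, the Jacobian of u equals (β̇/β)·I plus α/(β²·b) times the posterior second-moment matrix of the residual v(x, y) − u(x). -/

import Mathlib

open MeasureTheory RealInnerProductSpace

lemma aux_integrable {E W : Type*} [NormedAddCommGroup E] [MeasurableSpace E] [BorelSpace E]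
    [SecondCountableTopology E]
    [NormedAddCommGroup W] (μ : Measure E) [IsFiniteMeasure μ]
    (K : Set E) (hK : IsCompact K) (hμK : μ Kᶜ = 0) (f : E → W) (hf : Continuous f) :
    Integrable f μ := by
  obtain ⟨C, hC⟩ := hK.exists_bound_of_continuousOn hf.continuousOn
  refine Integrable.of_bound hf.aestronglyMeasurable C ?_
  have : ∀ᵐ y ∂μ, y ∈ K := by
    rw [ae_iff]; exact hμK
  filter_upwards [this] with y hy using hC y hy

lemma aux_deriv {E W : Type*} [NormedAddCommGroup E] [NormedSpace ℝ E] [FiniteDimensional ℝ E]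
    [MeasurableSpace E] [BorelSpace E] [SecondCountableTopology E]
    [NormedAddCommGroup W] [NormedSpace ℝ W] (μ : Measure E) [IsFiniteMeasure μ]
    (K : Set E) (hK : IsCompact K) (hμK : μ Kᶜ = 0) (F : E → E → W) (F' : E → E → E →L[ℝ] W)
    (hF : ∀ x, Continuous (F x)) (hF' : Continuous (fun q : E × E => F' q.1 q.2))
    (hd : ∀ x y, HasFDerivAt (fun x => F x y) (F' x y) x) (x₀ : E) :
    HasFDerivAt (fun x => ∫ y, F x y ∂μ) (∫ y, F' x₀ y ∂μ) x₀ := by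
  have : ProperSpace E := FiniteDimensional.proper ℝ E
  obtain ⟨C, hC⟩ := ((isCompact_closedBall x₀ 1).prod hK).exists_bound_of_continuousOn
    hF'.continuousOn
  have hae : ∀ᵐ y ∂μ, y ∈ K := by
    rw [ae_iff]; exact hμK
  refine hasFDerivAt_integral_of_dominated_of_fderiv_le (bound := fun _ => C)
    (Metric.closedBall_mem_nhds x₀ one_pos)
    (Filter.Eventually.of_forall fun x => (hF x).aestronglyMeasurable)
    (aux_integrable μ K hK hμK _ (hF x₀)) ?_ ?_ (integrable_const _) ?_
  · have : Continuous (F' x₀) := hF'.comp (by fun_prop : Continuous fun y : E => (x₀, y))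
    exact this.aestronglyMeasurable
  · filter_upwards [hae] with y hy x hx using hC (x, y) ⟨hx, hy⟩
  · exact Filter.Eventually.of_forall fun y x _ => hd x y

/-- Set `b = α̇ − α·β̇/β` and suppose `b ≠ 0`. Then the marginal velocity
`u` is differentiable on ℝ^d and for every direction `z`,
`(Du x) z = (β̇/β)•z + (α/(β²·b)) • ((1/p x) • ∫ ⟪v x y − u x, z⟫ · (v x y − u x) · g x y dμ(y))`;
that is, the Jacobian of `u` equals `(β̇/β)·I` plus `α/(β²·b)` times the posterior
second-moment matrix of the residual `v x y − u x`. -/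
theorem stmt_9
    (d : ℕ) (hd : 1 ≤ d)
    (α β αdot βdot : ℝ) (hα : 0 < α) (hβ : 0 < β)
    (μ : Measure (EuclideanSpace ℝ (Fin d))) [IsProbabilityMeasure μ]
    (K : Set (EuclideanSpace ℝ (Fin d))) (hK : IsCompact K) (hμK : μ Kᶜ = 0)
    (g : EuclideanSpace ℝ (Fin d) → EuclideanSpace ℝ (Fin d) → ℝ)
    (hg : ∀ x y, g x y =
      (2 * Real.pi * β ^ 2) ^ (-(d : ℝ) / 2) * Real.exp (-‖x - α • y‖ ^ 2 / (2 * β ^ 2)))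
    (p : EuclideanSpace ℝ (Fin d) → ℝ)
    (hp : ∀ x, p x = ∫ y, g x y ∂μ)
    (hppos : ∀ x, 0 < p x)
    (v : EuclideanSpace ℝ (Fin d) → EuclideanSpace ℝ (Fin d) → EuclideanSpace ℝ (Fin d))
    (hv : ∀ x y, v x y = αdot • y + (βdot / β) • (x - α • y))
    (u : EuclideanSpace ℝ (Fin d) → EuclideanSpace ℝ (Fin d))
    (hu : ∀ x, u x = (p x)⁻¹ • ∫ y, g x y • v x y ∂μ)
    (b : ℝ) (hb : b = αdot - α * βdot / β) (hbne : b ≠ 0) :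
    Differentiable ℝ u ∧
      ∀ x z, fderiv ℝ u x z = (βdot / β) • z +
        (α / (β ^ 2 * b)) •
          ((p x)⁻¹ • ∫ y, (⟪v x y - u x, z⟫ * g x y) • (v x y - u x) ∂μ) := by
  have hβ0 : β ≠ 0 := hβ.ne'
  have hgc : Continuous (fun q : EuclideanSpace ℝ (Fin d) × EuclideanSpace ℝ (Fin d) =>
      g q.1 q.2) := by
    simp only [hg]; fun_prop
  have hvc : Continuous (fun q : EuclideanSpace ℝ (Fin d) × EuclideanSpace ℝ (Fin d) =>
      v q.1 q.2) := by
    simp only [hv]; fun_prop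
  have hgcx : ∀ x, Continuous (g x) := fun x => by
    have : g x = fun y => g x y := rfl
    rw [this]; simp only [hg]; fun_prop
  have hvcx : ∀ x, Continuous (v x) := fun x => by
    have : v x = fun y => v x y := rfl
    rw [this]; simp only [hv]; fun_prop
  let g' : EuclideanSpace ℝ (Fin d) → EuclideanSpace ℝ (Fin d) →
      EuclideanSpace ℝ (Fin d) →L[ℝ] ℝ :=
    fun x y => (g x y * (-1 / β ^ 2)) • innerSL ℝ (x - α • y)
  have hg' : ∀ x y, HasFDerivAt (fun x => g x y) (g' x y) x := by
    intro x y
    have h1 : HasFDerivAt (fun x : EuclideanSpace ℝ (Fin d) => x - α • y)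
        (ContinuousLinearMap.id ℝ _) x := (hasFDerivAt_id x).sub_const _
    have h2 := ((h1.norm_sq.neg.mul_const (2 * β ^ 2)⁻¹).exp).const_mul
      ((2 * Real.pi * β ^ 2) ^ (-(d : ℝ) / 2))
    simp only [hg, div_eq_mul_inv] at h2 ⊢
    refine h2.congr_fderiv ?_
    ext z
    simp [g', hg, div_eq_mul_inv]
    field_simp
  have hg'c : Continuous (fun q : EuclideanSpace ℝ (Fin d) × EuclideanSpace ℝ (Fin d) =>
      g' q.1 q.2) := by
    simp only [g']; fun_prop
  have hg'cx : ∀ x, Continuous (g' x) := fun x =>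
    hg'c.comp (by fun_prop : Continuous fun y : EuclideanSpace ℝ (Fin d) => (x, y))
  have hv' : ∀ x y, HasFDerivAt (fun x => v x y)
      ((βdot / β) • ContinuousLinearMap.id ℝ (EuclideanSpace ℝ (Fin d))) x := by
    intro x y
    simp only [hv]
    exact (((hasFDerivAt_id (𝕜 := ℝ) x).sub_const (α • y)).const_smul (βdot / β)).const_add _
  have hpd : ∀ x, HasFDerivAt p (∫ y, g' x y ∂μ) x := by
    intro x
    have : p = fun x => ∫ y, g x y ∂μ := funext hp
    rw [this]
    exact aux_deriv μ K hK hμK g g' hgcx hg'c hg' x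
  let N' : EuclideanSpace ℝ (Fin d) → EuclideanSpace ℝ (Fin d) →
      EuclideanSpace ℝ (Fin d) →L[ℝ] EuclideanSpace ℝ (Fin d) := fun x y =>
    g x y • ((βdot / β) • ContinuousLinearMap.id ℝ (EuclideanSpace ℝ (Fin d))) +
      (g' x y).smulRight (v x y)
  have hN'c : Continuous (fun q : EuclideanSpace ℝ (Fin d) × EuclideanSpace ℝ (Fin d) =>
      N' q.1 q.2) := by
    simp only [N']
    refine (hgc.smul continuous_const).add ?_
    exact ((ContinuousLinearMap.smulRightL ℝ (EuclideanSpace ℝ (Fin d))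
      (EuclideanSpace ℝ (Fin d))).continuous.comp hg'c).clm_apply hvc
  have hN'cx : ∀ x, Continuous (N' x) := fun x =>
    hN'c.comp (by fun_prop : Continuous fun y : EuclideanSpace ℝ (Fin d) => (x, y))
  have hNd : ∀ x, HasFDerivAt (fun x => ∫ y, g x y • v x y ∂μ) (∫ y, N' x y ∂μ) x := by
    intro x
    exact aux_deriv μ K hK hμK (fun x y => g x y • v x y) N'
      (fun x => (hgcx x).smul (hvcx x)) hN'c (fun x y => (hg' x y).smul (hv' x y)) x
  have hud : ∀ x, HasFDerivAt u ((p x)⁻¹ • (∫ y, N' x y ∂μ) +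
      ((-(p x ^ 2)⁻¹) • (∫ y, g' x y ∂μ)).smulRight (∫ y, g x y • v x y ∂μ)) x := fun x => by
    have := ((hasDerivAt_inv (hppos x).ne').comp_hasFDerivAt x (hpd x)).smul (hNd x)
    exact this.congr_of_eventuallyEq (Filter.Eventually.of_forall hu)
  refine ⟨fun x => (hud x).differentiableAt, fun x z => ?_⟩
  have hint : ∀ {W : Type} [NormedAddCommGroup W] (f : EuclideanSpace ℝ (Fin d) → W),
      Continuous f → Integrable f μ := fun f hf => aux_integrable μ K hK hμK f hf
  have hp0 := (hppos x).ne'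
  have hNx : ∫ y, g x y • v x y ∂μ = p x • u x := by
    rw [hu, smul_smul, mul_inv_cancel₀ hp0, one_smul]
  have gx := hgcx x
  have vx := hvcx x
  have hz : ∫ y, g x y • (v x y - u x) ∂μ = 0 := by
    simp only [smul_sub]
    rw [integral_sub (hint _ (by fun_prop)) (hint _ (by fun_prop)), hNx, integral_smul_const,
      ← hp, sub_self]
  rw [(hud x).fderiv]
  simp only [ContinuousLinearMap.add_apply, ContinuousLinearMap.smul_apply,
    ContinuousLinearMap.smulRight_apply]
  rw [ContinuousLinearMap.integral_apply (hint _ (hN'cx x)),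
    ContinuousLinearMap.integral_apply (hint _ (hg'cx x)), hNx]
  have g'z : Continuous fun y => g' x y z := (hg'cx x).clm_apply continuous_const
  have e1 : ∫ y, N' x y z ∂μ = p x • ((βdot / β) • z) + ∫ y, g' x y z • v x y ∂μ := by
    simp only [N', ContinuousLinearMap.add_apply, ContinuousLinearMap.smul_apply,
      ContinuousLinearMap.smulRight_apply, ContinuousLinearMap.id_apply]
    rw [integral_add (hint _ (by fun_prop)) (hint _ (by fun_prop)), integral_smul_const, ← hp]
  have e2 : ∫ y, g' x y z • v x y ∂μ =
      (∫ y, g' x y z ∂μ) • u x + ∫ y, g' x y z • (v x y - u x) ∂μ := by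
    simp only [smul_sub]
    rw [integral_sub (hint _ (by fun_prop)) (hint _ (by fun_prop)), integral_smul_const]
    abel
  have e3 : ∫ y, g' x y z • (v x y - u x) ∂μ =
      (α / (β ^ 2 * b)) • ∫ y, (⟪v x y - u x, z⟫ * g x y) • (v x y - u x) ∂μ := by
    let w : EuclideanSpace ℝ (Fin d) :=
      (α / (β ^ 2 * b)) • (u x - (βdot / β) • x) - (1 / β ^ 2) • x
    have hw : ∀ y, (-1 / β ^ 2) • (x - α • y) = (α / (β ^ 2 * b)) • (v x y - u x) + w := by
      intro y
      have hvy : v x y = b • y + (βdot / β) • x := by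
        rw [hv, hb]; module
      rw [hvy]
      simp only [w]
      match_scalars <;> field_simp <;> ring
    have hpt : ∀ y, g' x y z • (v x y - u x) =
        (α / (β ^ 2 * b)) • ((⟪v x y - u x, z⟫ * g x y) • (v x y - u x)) +
          ⟪w, z⟫ • (g x y • (v x y - u x)) := by
      intro y
      have : g' x y z = g x y * ⟪(-1 / β ^ 2) • (x - α • y), z⟫ := by
        simp only [g', ContinuousLinearMap.smul_apply, innerSL_apply_apply, smul_eq_mul,
          real_inner_smul_left]
        ring
      rw [this, hw, inner_add_left, real_inner_smul_left]
      module
    simp only [hpt]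
    rw [integral_add (hint _ (by fun_prop)) (hint _ (by fun_prop)), integral_smul, integral_smul,
      hz, smul_zero, add_zero]
  rw [e1, e2, e3]
  generalize (∫ y, (⟪v x y - u x, z⟫ * g x y) • (v x y - u x) ∂μ) = J
  generalize (∫ y, g' x y z ∂μ) = q
  simp only [smul_eq_mul]
  match_scalars <;> field_simp <;> ring
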